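/- (Bilinear restriction implies linear restriction.) Let n ≥ 2 and let p satisfy 2n/(n−1) < p ≤ 4 if n ≥ 3, or p > 4 if n = 2. Suppose there is a constant C_0 < ∞ such that ‖|E_{Ω_1}f · E_{Ω_2}f|^{1/2}‖_{L^p(ℝ^n)} ≤ C_0 (‖f‖_{L^∞(Ω_1)} ‖f‖_{L^∞(Ω_2)})^{1/2} for all pairs of cubes Ω_1, Ω_2 ⊆ [−1,1]^{n−1} with d(Ω_1, Ω_2) ≥ 1/2 and all bounded measurable f : Ω_1 ∪ Ω_2 → ℂ. Then there is a constant C < ∞ such that ‖E_{[−1,1]^{n−1}} f‖_{L^p(ℝ^n)} ≤ C ‖f‖_{L^∞([−1,1]^{n−1})} for all bounded measurable f : [−1,1]^{n−1} → ℂ. -/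

import Mathlib

open MeasureTheory Real Complex RealInnerProductSpace ENNReal

/-- The paraboloid extension operator
`E_Ω f(x) = ∫_Ω f(ξ) e^{2πi(x′·ξ + x_n |ξ|²)} dξ`, on `ℝ^n = ℝ^{n−1} × ℝ`. -/
noncomputable def parabExt {m : ℕ} (Ω : Set (EuclideanSpace ℝ (Fin m)))
    (f : EuclideanSpace ℝ (Fin m) → ℂ) (x : EuclideanSpace ℝ (Fin m) × ℝ) : ℂ :=
  ∫ ξ in Ω, f ξ * Complex.exp (2 * Real.pi * Complex.I * ((⟪x.1, ξ⟫ + x.2 * ∑ i, ξ i ^ 2 : ℝ)))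

/-- The axis-parallel cube with corner `a` and side length `s`. -/
def cube {m : ℕ} (a : EuclideanSpace ℝ (Fin m)) (s : ℝ) : Set (EuclideanSpace ℝ (Fin m)) :=
  {ξ | ∀ i, ξ i ∈ Set.Icc (a i) (a i + s)}

namespace BilLin

/-- The phase of the extension operator. -/
noncomputable def phs {m : ℕ} (x : EuclideanSpace ℝ (Fin m) × ℝ) (ξ : EuclideanSpace ℝ (Fin m)) : ℝ :=
  ⟪x.1, ξ⟫ + x.2 * ∑ i, ξ i ^ 2

/-- Extension operator on the whole space. -/
noncomputable def Ext {m : ℕ} (h : EuclideanSpace ℝ (Fin m) → ℂ)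
    (x : EuclideanSpace ℝ (Fin m) × ℝ) : ℂ :=
  ∫ ξ, h ξ * Complex.exp (2 * Real.pi * Complex.I * (phs x ξ : ℝ))

lemma norm_phase {m : ℕ} (x : EuclideanSpace ℝ (Fin m) × ℝ) (ξ : EuclideanSpace ℝ (Fin m)) :
    ‖Complex.exp (2 * Real.pi * Complex.I * (phs x ξ : ℝ))‖ = 1 := by
  have : (2 * Real.pi * Complex.I * (phs x ξ : ℝ) : ℂ) = ((2 * Real.pi * phs x ξ : ℝ) : ℂ) * Complex.I := by
    push_cast; ring
  rw [this, Complex.norm_exp_ofReal_mul_I]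

lemma continuous_phs {m : ℕ} : Continuous
    (fun q : (EuclideanSpace ℝ (Fin m) × ℝ) × EuclideanSpace ℝ (Fin m) => phs q.1 q.2) := by
  unfold phs; fun_prop

lemma measurable_Ext {m : ℕ} {h : EuclideanSpace ℝ (Fin m) → ℂ} (hh : Measurable h) :
    Measurable (Ext h) := by
  have : StronglyMeasurable (fun q : (EuclideanSpace ℝ (Fin m) × ℝ) × EuclideanSpace ℝ (Fin m) =>
      h q.2 * Complex.exp (2 * Real.pi * Complex.I * (phs q.1 q.2 : ℝ))) := by
    apply Measurable.stronglyMeasurable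
    apply Measurable.mul (hh.comp measurable_snd)
    apply Continuous.measurable
    have := continuous_phs (m := m)
    fun_prop
  exact (this.integral_prod_right).measurable

/-- The unit cube. -/
def U (m : ℕ) : Set (EuclideanSpace ℝ (Fin m)) := {ξ | ∀ i, ξ i ∈ Set.Icc (-1 : ℝ) 1}

lemma measurableSet_cube {m : ℕ} (a : EuclideanSpace ℝ (Fin m)) (s : ℝ) :
    MeasurableSet (cube a s) := by
  have : cube a s = ⋂ i, (fun ξ : EuclideanSpace ℝ (Fin m) => ξ i) ⁻¹' Set.Icc (a i) (a i + s) := by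
    ext; simp [cube]
  rw [this]
  exact MeasurableSet.iInter fun i => (by fun_prop : Measurable _) measurableSet_Icc

lemma isBounded_box {m : ℕ} (R : ℝ) :
    Bornology.IsBounded {ξ : EuclideanSpace ℝ (Fin m) | ∀ i, |ξ i| ≤ R} := by
  rw [isBounded_iff_forall_norm_le]
  refine ⟨√ (∑ i : Fin m, R ^ 2), fun ξ hξ => ?_⟩
  rw [EuclideanSpace.norm_eq]
  apply Real.sqrt_le_sqrt
  apply Finset.sum_le_sum
  intro i _
  rw [Real.norm_eq_abs]
  exact pow_le_pow_left₀ (abs_nonneg _) (hξ i) 2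

lemma U_eq (m : ℕ) : U m = {ξ : EuclideanSpace ℝ (Fin m) | ∀ i, |ξ i| ≤ 1} := by
  ext; simp [U, abs_le]

lemma measurableSet_U (m : ℕ) : MeasurableSet (U m) := by
  have : U m = cube (WithLp.toLp 2 fun _ => -1) 2 := by
    ext x
    simp only [U, cube, Set.mem_ofPred_eq, Set.mem_Icc]
    refine forall_congr' fun i => ?_
    constructor <;> rintro ⟨h1, h2⟩ <;> constructor <;> linarith
  rw [this]; exact measurableSet_cube _ _

lemma volume_U_lt (m : ℕ) : volume (U m) < ⊤ := by
  rw [U_eq]; exact (isBounded_box 1).measure_lt_top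

lemma parabExt_eq {m : ℕ} {Ω : Set (EuclideanSpace ℝ (Fin m))} (hΩ : MeasurableSet Ω)
    (f : EuclideanSpace ℝ (Fin m) → ℂ) : parabExt Ω f = Ext (Ω.indicator f) := by
  ext x
  unfold parabExt Ext phs
  rw [← integral_indicator hΩ]
  congr 1; ext ξ
  by_cases h : ξ ∈ Ω <;> simp [h]

/-- Admissible functions. -/
structure Adm {m : ℕ} (S : Set (EuclideanSpace ℝ (Fin m))) (h : EuclideanSpace ℝ (Fin m) → ℂ) : Prop where
  meas : Measurable h
  bd : ∀ ξ, ‖h ξ‖ ≤ 1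
  supp : ∀ ξ, ξ ∉ S → h ξ = 0

lemma Adm.mono {m : ℕ} {S S' : Set (EuclideanSpace ℝ (Fin m))} {h : EuclideanSpace ℝ (Fin m) → ℂ}
    (H : Adm S h) (hS : S ⊆ S') : Adm S' h :=
  ⟨H.meas, H.bd, fun ξ hξ => H.supp ξ fun h' => hξ (hS h')⟩

lemma Adm.integrable {m : ℕ} {h : EuclideanSpace ℝ (Fin m) → ℂ} (H : Adm (U m) h) :
    Integrable h := by
  have h1 : Integrable ((U m).indicator fun _ : EuclideanSpace ℝ (Fin m) => (1 : ℝ)) :=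
    (integrable_indicator_iff (measurableSet_U m)).2
      (integrableOn_const (volume_U_lt m).ne)
  refine h1.mono' H.meas.aestronglyMeasurable (Filter.Eventually.of_forall fun ξ => ?_)
  by_cases hξ : ξ ∈ U m
  · simpa [hξ] using H.bd ξ
  · simp [hξ, H.supp ξ hξ]

lemma Adm.integrable_phase {m : ℕ} {h : EuclideanSpace ℝ (Fin m) → ℂ} (H : Adm (U m) h)
    (x : EuclideanSpace ℝ (Fin m) × ℝ) :
    Integrable fun ξ => h ξ * Complex.exp (2 * Real.pi * Complex.I * (phs x ξ : ℝ)) := by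
  refine H.integrable.norm.mono' ?_ (Filter.Eventually.of_forall fun ξ => ?_)
  · apply Measurable.aestronglyMeasurable
    apply H.meas.mul
    apply Continuous.measurable
    have := continuous_phs (m := m)
    have h2 : Continuous (fun ξ => phs x ξ) := this.comp (by fun_prop : Continuous fun ξ => (x, ξ))
    fun_prop
  · rw [norm_mul, norm_phase, mul_one]

lemma Adm.enorm_Ext_le {m : ℕ} {h : EuclideanSpace ℝ (Fin m) → ℂ} (H : Adm (U m) h)
    (x : EuclideanSpace ℝ (Fin m) × ℝ) : ‖Ext h x‖ₑ ≤ volume (U m) := by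
  unfold Ext
  refine (enorm_integral_le_lintegral_enorm _).trans ?_
  calc _ ≤ ∫⁻ ξ, (U m).indicator (fun _ => 1) ξ := by
        apply lintegral_mono
        intro ξ
        dsimp only
        by_cases hξ : ξ ∈ U m
        · simp only [hξ, Set.indicator_of_mem]
          rw [← ofReal_norm, norm_mul, norm_phase, mul_one]
          exact ENNReal.ofReal_le_one.2 (H.bd ξ)
        · simp [hξ, H.supp ξ hξ]
    _ = _ := by simp [lintegral_indicator (measurableSet_U m)]

/-- Parabolic rescaling map. -/
noncomputable def T {m : ℕ} (a : EuclideanSpace ℝ (Fin m)) (δ : ℝ)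
    (x : EuclideanSpace ℝ (Fin m) × ℝ) : EuclideanSpace ℝ (Fin m) × ℝ :=
  (δ • (x.1 + (2 * x.2) • a), δ ^ 2 * x.2)

lemma phs_rescale {m : ℕ} (a : EuclideanSpace ℝ (Fin m)) (δ : ℝ)
    (x : EuclideanSpace ℝ (Fin m) × ℝ) (η : EuclideanSpace ℝ (Fin m)) :
    phs x (a + δ • η) = phs x a + phs (T a δ x) η := by
  unfold phs T
  simp only [inner_add_left, inner_add_right, inner_smul_left, inner_smul_right, PiLp.add_apply,
    PiLp.smul_apply, smul_eq_mul, PiLp.inner_apply, RCLike.inner_apply, conj_trivial,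
    Finset.mul_sum, ← Finset.sum_add_distrib]
  apply Finset.sum_congr rfl
  intro i _
  ring

lemma Ext_rescale {m : ℕ} (h : EuclideanSpace ℝ (Fin m) → ℂ) (a : EuclideanSpace ℝ (Fin m)) {δ : ℝ}
    (hδ : 0 < δ) (x : EuclideanSpace ℝ (Fin m) × ℝ) :
    ‖Ext h x‖ₑ = ENNReal.ofReal (δ ^ m) * ‖Ext (fun η => h (a + δ • η)) (T a δ x)‖ₑ := by
  set F : EuclideanSpace ℝ (Fin m) → ℂ := fun ξ =>
    h ξ * Complex.exp (2 * Real.pi * Complex.I * (phs x ξ : ℝ)) with hF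
  have h1 : Ext h x = ∫ ξ, F (a + ξ) := (integral_add_left_eq_self F a).symm
  have h2 := Measure.integral_comp_smul volume (fun ξ => F (a + ξ)) δ
  rw [← h1] at h2
  have h3 : (∫ η, F (a + δ • η)) = Complex.exp (2 * Real.pi * Complex.I * (phs x a : ℝ)) *
      Ext (fun η => h (a + δ • η)) (T a δ x) := by
    unfold Ext
    rw [← integral_const_mul]
    congr 1; ext η
    simp only [hF, phs_rescale]
    push_cast
    rw [mul_add, Complex.exp_add]
    ring
  rw [h3] at h2
  have h4 := congrArg norm h2
  rw [norm_mul, norm_phase, one_mul, norm_smul, finrank_euclideanSpace, Fintype.card_fin,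
    Real.norm_eq_abs, abs_abs, abs_of_pos (by positivity)] at h4
  rw [← ofReal_norm, ← ofReal_norm, ← ENNReal.ofReal_mul (by positivity), h4]
  congr 1
  field_simp

lemma lintegral_T {m : ℕ} (a : EuclideanSpace ℝ (Fin m)) {δ : ℝ} (hδ : 0 < δ)
    {F : EuclideanSpace ℝ (Fin m) × ℝ → ℝ≥0∞} (hF : Measurable F) :
    ∫⁻ x, F (T a δ x) = ENNReal.ofReal ((δ ^ (m + 2))⁻¹) * ∫⁻ x, F x := by
  have hT : Measurable (T (m := m) a δ) := by
    unfold T; fun_prop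
  have sm : ∀ {E : Type} [NormedAddCommGroup E] [NormedSpace ℝ E] [FiniteDimensional ℝ E]
      [MeasurableSpace E] [BorelSpace E] (μ : Measure E) [μ.IsAddHaarMeasure] (r : ℝ), 0 < r →
      ∀ f : E → ℝ≥0∞, Measurable f →
      ∫⁻ y, f (r • y) ∂μ = ENNReal.ofReal ((r ^ Module.finrank ℝ E)⁻¹) * ∫⁻ y, f y ∂μ := by
    intro E _ _ _ _ _ μ _ r hr f hf
    rw [← lintegral_map (f := f) hf (measurable_const_smul r), Measure.map_addHaar_smul _ hr.ne',
      lintegral_smul_measure, abs_of_pos (by positivity)]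
    rfl
  rw [Measure.volume_eq_prod, lintegral_prod_symm _ (by fun_prop), lintegral_prod_symm _ (by fun_prop)]
  have h1 : ∀ t : ℝ, ∫⁻ y : EuclideanSpace ℝ (Fin m), F (T a δ (y, t)) =
      ENNReal.ofReal ((δ ^ m)⁻¹) * ∫⁻ y, F (y, δ ^ 2 * t) := by
    intro t
    have := lintegral_add_right_eq_self (μ := (volume : Measure (EuclideanSpace ℝ (Fin m))))
      (fun y => F (δ • y, δ ^ 2 * t)) ((2 * t) • a)
    unfold T
    dsimp only at this ⊢
    rw [this, sm volume δ hδ (fun y => F (y, δ ^ 2 * t)) (by fun_prop)]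
    simp
  simp_rw [h1]
  have hm : Measurable fun t : ℝ => ∫⁻ y : EuclideanSpace ℝ (Fin m), F (y, t) :=
    hF.lintegral_prod_left'
  rw [lintegral_const_mul _ (by fun_prop)]
  have h2 := sm (volume : Measure ℝ) (δ ^ 2) (by positivity) (fun t => ∫⁻ y : EuclideanSpace ℝ (Fin m), F (y, t)) hm
  simp only [smul_eq_mul] at h2
  rw [h2, ← mul_assoc, ← ENNReal.ofReal_mul (by positivity)]
  congr 2
  simp [pow_add, mul_comm]

/-- Truncation region. -/
def S (m : ℕ) (R : ℝ) : Set (EuclideanSpace ℝ (Fin m) × ℝ) :=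
  {ξ | ∀ i, |ξ i| ≤ R} ×ˢ {t | |t| ≤ R}

lemma mem_S {m : ℕ} {R : ℝ} {x : EuclideanSpace ℝ (Fin m) × ℝ} :
    x ∈ S m R ↔ (∀ i, |x.1 i| ≤ R) ∧ |x.2| ≤ R := Iff.rfl

lemma measurableSet_S (m : ℕ) (R : ℝ) : MeasurableSet (S m R) := by
  apply IsClosed.measurableSet
  have : S m R = (⋂ i, {x : EuclideanSpace ℝ (Fin m) × ℝ | |x.1 i| ≤ R}) ∩ {x | |x.2| ≤ R} := by
    ext x; simp [mem_S]
  rw [this]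
  refine IsClosed.inter (isClosed_iInter fun i => ?_) ?_
  · exact isClosed_le (by fun_prop) (by fun_prop)
  · exact isClosed_le (by fun_prop) (by fun_prop)

lemma volume_S_lt (m : ℕ) (R : ℝ) : volume (S m R) < ⊤ := by
  apply Bornology.IsBounded.measure_lt_top
  refine Bornology.IsBounded.prod (isBounded_box R) ?_
  rw [isBounded_iff_forall_norm_le]
  exact ⟨R, fun t ht => ht⟩

lemma T_mem_S {m : ℕ} {a : EuclideanSpace ℝ (Fin m)} (ha : a ∈ U m) {δ : ℝ} (hδ : 0 < δ)
    (hδ' : 3 * δ ≤ 1) {R : ℝ} {x : EuclideanSpace ℝ (Fin m) × ℝ} (hx : x ∈ S m R) :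
    T a δ x ∈ S m R := by
  rw [mem_S] at hx ⊢
  obtain ⟨h1, h2⟩ := hx
  have hR : 0 ≤ R := (abs_nonneg _).trans h2
  rw [U_eq] at ha
  constructor
  · intro i
    have hi := h1 i
    have hai := ha i
    simp only [T, PiLp.smul_apply, PiLp.add_apply, smul_eq_mul]
    rw [abs_mul, abs_of_pos hδ]
    have : |x.1 i + 2 * x.2 * a i| ≤ 3 * R := by
      refine (abs_add_le _ _).trans ?_
      rw [abs_mul, abs_mul, abs_two]
      have := mul_le_mul h2 hai (abs_nonneg _) hR
      linarith
    calc δ * |x.1 i + 2 * x.2 * a i| ≤ δ * (3 * R) := by gcongr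
      _ = (3 * δ) * R := by ring
      _ ≤ 1 * R := by gcongr
      _ = R := one_mul R
  · simp only [T]
    rw [abs_mul, abs_of_pos (by positivity)]
    have : δ ^ 2 ≤ 1 := by nlinarith
    calc δ ^ 2 * |x.2| ≤ 1 * R := by gcongr
      _ = R := one_mul R

lemma lintegral_rescale {m : ℕ} (a : EuclideanSpace ℝ (Fin m)) {δ : ℝ} (hδ : 0 < δ) {p : ℝ} (hp : 0 ≤ p)
    {F : EuclideanSpace ℝ (Fin m) × ℝ → ℝ≥0∞} (hF : Measurable F) :
    ∫⁻ x, ENNReal.ofReal (δ ^ m) ^ p * F (T a δ x) =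
      ENNReal.ofReal (δ ^ ((m : ℝ) * p - (m + 2))) * ∫⁻ x, F x := by
  have hT : Measurable (T (m := m) a δ) := by
    unfold T; fun_prop
  rw [lintegral_const_mul _ (by fun_prop), lintegral_T a hδ hF, ← mul_assoc,
    ENNReal.ofReal_rpow_of_nonneg (by positivity) hp, ← ENNReal.ofReal_mul (by positivity)]
  congr 2
  rw [Real.rpow_sub hδ, Real.rpow_mul hδ.le, Real.rpow_natCast, div_eq_mul_inv]
  congr 2
  rw [← Real.rpow_natCast]
  push_cast; rfl

lemma lin_rescale {m : ℕ} {a : EuclideanSpace ℝ (Fin m)} (ha : a ∈ U m) {δ : ℝ} (hδ : 0 < δ)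
    (hδ' : 3 * δ ≤ 1) {p : ℝ} (hp : 0 ≤ p) (R : ℝ) {h : EuclideanSpace ℝ (Fin m) → ℂ}
    (hh : Measurable h) :
    ∫⁻ x in S m R, ‖Ext h x‖ₑ ^ p ≤ ENNReal.ofReal (δ ^ ((m : ℝ) * p - (m + 2))) *
      ∫⁻ x in S m R, ‖Ext (fun η => h (a + δ • η)) x‖ₑ ^ p := by
  have hm : Measurable (Ext (fun η => h (a + δ • η))) := measurable_Ext (by fun_prop)
  rw [← lintegral_indicator (measurableSet_S m R), ← lintegral_indicator (measurableSet_S m R),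
    ← lintegral_rescale a hδ hp ((by fun_prop : Measurable _).indicator (measurableSet_S m R))]
  apply lintegral_mono
  intro x
  by_cases hx : x ∈ S m R
  · have := T_mem_S ha hδ hδ' hx
    simp only [hx, this, Set.indicator_of_mem]
    rw [Ext_rescale h a hδ x, ENNReal.mul_rpow_of_nonneg _ _ hp]
  · simp [hx]

lemma bil_rescale {m : ℕ} (a : EuclideanSpace ℝ (Fin m)) {δ : ℝ} (hδ : 0 < δ)
    {p : ℝ} (hp : 0 ≤ p) {h₁ h₂ : EuclideanSpace ℝ (Fin m) → ℂ}
    (hh₁ : Measurable h₁) (hh₂ : Measurable h₂) :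
    ∫⁻ x, (‖Ext h₁ x‖ₑ * ‖Ext h₂ x‖ₑ) ^ (p / 2) = ENNReal.ofReal (δ ^ ((m : ℝ) * p - (m + 2))) *
      ∫⁻ x, (‖Ext (fun η => h₁ (a + δ • η)) x‖ₑ * ‖Ext (fun η => h₂ (a + δ • η)) x‖ₑ) ^ (p / 2) := by
  have hm₁ : Measurable (Ext (fun η => h₁ (a + δ • η))) := measurable_Ext (by fun_prop)
  have hm₂ : Measurable (Ext (fun η => h₂ (a + δ • η))) := measurable_Ext (by fun_prop)
  rw [← lintegral_rescale a hδ hp (by fun_prop)]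
  apply lintegral_congr
  intro x
  rw [Ext_rescale h₁ a hδ x, Ext_rescale h₂ a hδ x, mul_mul_mul_comm,
    ENNReal.mul_rpow_of_nonneg _ _ (by positivity : 0 ≤ p / 2), ← sq, ← ENNReal.rpow_natCast,
    ← ENNReal.rpow_mul]
  congr 2
  push_cast; ring

/-- Bilinear hypothesis in normalized form. -/
def BilHyp (m : ℕ) (p : ℝ) (B : ℝ≥0∞) : Prop :=
  ∀ (a₁ a₂ : EuclideanSpace ℝ (Fin m)) (s₁ s₂ : ℝ), 0 < s₁ → 0 < s₂ → cube a₁ s₁ ⊆ U m →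
    cube a₂ s₂ ⊆ U m → (∀ x ∈ cube a₁ s₁, ∀ y ∈ cube a₂ s₂, (1 : ℝ) / 2 ≤ dist x y) →
    ∀ h₁ h₂ : EuclideanSpace ℝ (Fin m) → ℂ, Adm (cube a₁ s₁) h₁ → Adm (cube a₂ s₂) h₂ →
    ∫⁻ x, (‖Ext h₁ x‖ₑ * ‖Ext h₂ x‖ₑ) ^ (p / 2) ≤ B

/-- Index of the grid interval. -/
noncomputable def idx (K : ℕ) (y : ℝ) : ℕ := min ⌊(y + 1) * K / 2⌋₊ (K - 1)

lemma measurable_idx (K : ℕ) : Measurable (idx K) := by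
  unfold idx
  exact (Nat.measurable_floor.comp (by fun_prop)).min measurable_const

lemma idx_lt {K : ℕ} (hK : 0 < K) (y : ℝ) : idx K y < K := by
  unfold idx; omega

lemma idx_bounds {K : ℕ} (hK : 0 < K) {y : ℝ} (hy : y ∈ Set.Icc (-1 : ℝ) 1) :
    -1 + 2 * (idx K y : ℝ) / K ≤ y ∧ y ≤ -1 + 2 * (idx K y : ℝ) / K + 2 / K := by
  have hK' : (0 : ℝ) < K := by exact_mod_cast hK
  obtain ⟨h1, h2⟩ := hy
  have hz : 0 ≤ (y + 1) * K / 2 := by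
    have : 0 ≤ y + 1 := by linarith
    positivity
  have hzK : (y + 1) * K / 2 ≤ K := by
    have : (y + 1) * K ≤ 2 * K := by gcongr; linarith
    linarith
  have key : (idx K y : ℝ) ≤ (y + 1) * K / 2 ∧ (y + 1) * K / 2 ≤ idx K y + 1 := by
    constructor
    · refine le_trans ?_ (Nat.floor_le hz)
      exact_mod_cast min_le_left _ _
    · unfold idx
      rcases le_total ⌊(y + 1) * K / 2⌋₊ (K - 1) with h | h
      · rw [min_eq_left h]
        exact (Nat.lt_floor_add_one _).le
      · rw [min_eq_right h]
        have : ((K - 1 : ℕ) : ℝ) + 1 = K := by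
          rw [Nat.cast_sub (by omega)]; simp
        rw [this]; exact hzK
  obtain ⟨k1, k2⟩ := key
  have e : y = -1 + 2 * ((y + 1) * K / 2) / K := by field_simp; ring
  constructor
  · rw [e]
    have e' : -1 + 2 * ((y + 1) * K / 2) / K + 1 = 2 * ((y + 1) * K / 2) / K := by ring
    have : 2 * (idx K y : ℝ) / K ≤ 2 * ((y + 1) * K / 2) / K := by gcongr
    rw [← e]; linarith
  · have : 2 * ((y + 1) * K / 2) / K ≤ 2 * ((idx K y : ℝ) + 1) / K := by gcongr
    have e2 : 2 * ((idx K y : ℝ) + 1) / K = 2 * (idx K y : ℝ) / K + 2 / K := by ring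
    linarith

/-- Half-open grid cell. -/
def cell {m : ℕ} (K : ℕ) (k : Fin m → Fin K) : Set (EuclideanSpace ℝ (Fin m)) :=
  {ξ | ∀ i, idx K (ξ i) = k i}

lemma measurableSet_cell {m : ℕ} (K : ℕ) (k : Fin m → Fin K) : MeasurableSet (cell K k) := by
  have : cell K k = ⋂ i, (fun ξ : EuclideanSpace ℝ (Fin m) => idx K (ξ i)) ⁻¹' {(k i : ℕ)} := by
    ext; simp [cell]
  rw [this]
  exact MeasurableSet.iInter fun i =>
    ((measurable_idx K).comp (by fun_prop)) (measurableSet_singleton _)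

/-- Restriction of `g` to a cell. -/
noncomputable def piece {m : ℕ} (K : ℕ) (g : EuclideanSpace ℝ (Fin m) → ℂ) (k : Fin m → Fin K) :
    EuclideanSpace ℝ (Fin m) → ℂ := (cell K k).indicator g

lemma sum_piece {m K : ℕ} (hK : 0 < K) (g : EuclideanSpace ℝ (Fin m) → ℂ)
    (ξ : EuclideanSpace ℝ (Fin m)) : ∑ k, piece K g k ξ = g ξ := by
  set k₀ : Fin m → Fin K := fun i => ⟨idx K (ξ i), idx_lt hK _⟩ with hk₀
  rw [Finset.sum_eq_single k₀]
  · exact Set.indicator_of_mem (by intro i; simp [hk₀]) _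
  · intro k _ hk
    refine Set.indicator_of_notMem (fun h => hk ?_) _
    ext i
    simp [hk₀, h i]
  · simp

/-- Lower corner of a grid cube. -/
noncomputable def corner {m K : ℕ} (k : Fin m → Fin K) : EuclideanSpace ℝ (Fin m) :=
  WithLp.toLp 2 fun i => -1 + 2 * ((k i : ℕ) : ℝ) / K

lemma adm_piece_cube {m K : ℕ} (hK : 0 < K) {g : EuclideanSpace ℝ (Fin m) → ℂ} (hg : Adm (U m) g)
    (k : Fin m → Fin K) : Adm (cube (corner k) (2 / K)) (piece K g k) := by
  refine ⟨hg.meas.indicator (measurableSet_cell K k), fun ξ => ?_, fun ξ hξ => ?_⟩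
  · unfold piece
    refine (norm_indicator_le_norm_self _ _).trans (hg.bd ξ)
  · unfold piece
    by_cases hc : ξ ∈ cell K k
    · rw [Set.indicator_of_mem hc]
      apply hg.supp
      intro hU
      apply hξ
      intro i
      have := idx_bounds hK (hU i)
      rw [hc i] at this
      exact this
    · exact Set.indicator_of_notMem hc _

lemma adm_piece_U {m K : ℕ} {g : EuclideanSpace ℝ (Fin m) → ℂ} (hg : Adm (U m) g)
    (k : Fin m → Fin K) : Adm (U m) (piece K g k) := by
  refine ⟨hg.meas.indicator (measurableSet_cell K k), fun ξ => ?_, fun ξ hξ => ?_⟩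
  · exact (norm_indicator_le_norm_self _ _).trans (hg.bd ξ)
  · unfold piece
    by_cases hc : ξ ∈ cell K k
    · rw [Set.indicator_of_mem hc, hg.supp ξ hξ]
    · exact Set.indicator_of_notMem hc _

lemma Ext_sum_piece {m K : ℕ} (hK : 0 < K) {g : EuclideanSpace ℝ (Fin m) → ℂ} (hg : Adm (U m) g)
    (x : EuclideanSpace ℝ (Fin m) × ℝ) : Ext g x = ∑ k, Ext (piece K g k) x := by
  unfold Ext
  rw [← integral_finsetSum _ fun k _ => (adm_piece_U hg k).integrable_phase x]
  congr 1; ext ξ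
  rw [← Finset.sum_mul, sum_piece hK]

lemma Adm.rescale {m : ℕ} {h : EuclideanSpace ℝ (Fin m) → ℂ} {c a : EuclideanSpace ℝ (Fin m)}
    {s δ : ℝ} (hδ : 0 < δ) (H : Adm (cube c s) h) :
    Adm (cube (δ⁻¹ • (c - a)) (s / δ)) (fun η => h (a + δ • η)) := by
  refine ⟨H.meas.comp (by fun_prop), fun ξ => H.bd _, fun η hη => H.supp _ fun hc => hη ?_⟩
  intro i
  have := hc i
  simp only [PiLp.add_apply, PiLp.smul_apply, smul_eq_mul, Set.mem_Icc, PiLp.sub_apply] at this ⊢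
  obtain ⟨h1, h2⟩ := this
  constructor
  · rw [inv_mul_le_iff₀ hδ]; linarith
  · rw [inv_mul_eq_div, ← add_div, le_div_iff₀ hδ]; linarith

lemma piece_lin {m K : ℕ} (hK : 3 ≤ K) {p : ℝ} (hp : 0 ≤ p) (R : ℝ)
    {g : EuclideanSpace ℝ (Fin m) → ℂ} (hg : Adm (U m) g) (k : Fin m → Fin K) :
    ∃ g', Adm (U m) g' ∧ ∫⁻ x in S m R, ‖Ext (piece K g k) x‖ₑ ^ p ≤
      ENNReal.ofReal ((1 / K : ℝ) ^ ((m : ℝ) * p - (m + 2))) *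
      ∫⁻ x in S m R, ‖Ext g' x‖ₑ ^ p := by
  have hK' : (3 : ℝ) ≤ K := by exact_mod_cast hK
  have hK0 : (0 : ℝ) < K := by linarith
  set a : EuclideanSpace ℝ (Fin m) := WithLp.toLp 2 fun i => -1 + (2 * ((k i : ℕ) : ℝ) + 1) / K with ha
  have H := adm_piece_cube (by omega) hg k
  have hδ : (0 : ℝ) < 1 / K := by positivity
  refine ⟨_, (H.rescale (a := a) hδ).mono ?_, lin_rescale (a := a) ?_ hδ ?_ hp R H.meas⟩
  · intro η hη i
    have := hη i
    simp only [corner, ha, PiLp.smul_apply, PiLp.sub_apply, smul_eq_mul] at this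
    have e1 : (1 / (K : ℝ))⁻¹ * (-1 + 2 * ((k i : ℕ) : ℝ) / K - (-1 + (2 * ((k i : ℕ) : ℝ) + 1) / K)) = -1 := by
      field_simp; ring
    have e2 : 2 / (K : ℝ) / (1 / K) = 2 := by field_simp
    rw [e1, e2] at this
    exact ⟨this.1, by linarith [this.2]⟩
  · intro i
    have hk : ((k i : ℕ) : ℝ) + 1 ≤ K := by exact_mod_cast (k i).2
    simp only [ha, Set.mem_Icc]
    constructor
    · have : 0 ≤ (2 * ((k i : ℕ) : ℝ) + 1) / K := by positivity
      linarith
    · have : (2 * ((k i : ℕ) : ℝ) + 1) / K ≤ 2 := by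
        rw [div_le_iff₀ hK0]; linarith
      linarith
  · rw [mul_one_div, div_le_one hK0]; exact hK'

lemma piece_bil {m K : ℕ} {p : ℝ} (hp : 0 ≤ p) (hmp : 0 ≤ (m : ℝ) * p - (m + 2)) {B : ℝ≥0∞}
    (hB : BilHyp m p B) {g : EuclideanSpace ℝ (Fin m) → ℂ} (hg : Adm (U m) g)
    (k l : Fin m → Fin K) (hkl : ¬ ∀ i, |((k i : ℕ) : ℤ) - ((l i : ℕ) : ℤ)| ≤ 1) :
    ∫⁻ x, (‖Ext (piece K g k) x‖ₑ * ‖Ext (piece K g l) x‖ₑ) ^ (p / 2) ≤ B := by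
  push Not at hkl
  obtain ⟨i₁, hi₁⟩ := hkl
  have : Nonempty (Fin m) := ⟨i₁⟩
  have hKpos : 0 < K := lt_of_le_of_lt (Nat.zero_le _) (k i₁).2
  have hK0 : (0 : ℝ) < K := by exact_mod_cast hKpos
  obtain ⟨i₀, hi₀⟩ := Finite.exists_max (fun i => |((k i : ℕ) : ℤ) - ((l i : ℕ) : ℤ)|)
  set D : ℝ := |((k i₀ : ℕ) : ℝ) - ((l i₀ : ℕ) : ℝ)| with hD
  have hDmax : ∀ i, |((k i : ℕ) : ℝ) - ((l i : ℕ) : ℝ)| ≤ D := by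
    intro i; have := hi₀ i; rw [hD]; exact_mod_cast this
  have hD2 : 2 ≤ D := by
    have : (2 : ℤ) ≤ |((k i₀ : ℕ) : ℤ) - ((l i₀ : ℕ) : ℤ)| := by
      have := hi₀ i₁
      omega
    rw [hD]; exact_mod_cast this
  have hDK : D + 1 ≤ K := by
    have h1 : ((k i₀ : ℕ) : ℝ) + 1 ≤ K := by exact_mod_cast (k i₀).2
    have h2 : ((l i₀ : ℕ) : ℝ) + 1 ≤ K := by exact_mod_cast (l i₀).2
    have h3 : (0 : ℝ) ≤ ((k i₀ : ℕ) : ℝ) := by positivity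
    have h4 : (0 : ℝ) ≤ ((l i₀ : ℕ) : ℝ) := by positivity
    have : D ≤ K - 1 := by
      rw [hD, abs_le]; constructor <;> linarith
    linarith
  have hD1 : 0 < D + 1 := by linarith
  set δ : ℝ := (D + 1) / K with hδdef
  have hδ : 0 < δ := by positivity
  have hδ1 : δ ≤ 1 := by rw [hδdef, div_le_one hK0]; exact hDK
  set mn : Fin m → ℝ := fun i => min ((k i : ℕ) : ℝ) ((l i : ℕ) : ℝ) with hmn
  set a : EuclideanSpace ℝ (Fin m) := WithLp.toLp 2 fun i => -1 + 2 * mn i / K + (D + 1) / K with ha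
  have Hk := adm_piece_cube hKpos hg k
  have Hl := adm_piece_cube hKpos hg l
  have hside : 2 / (K : ℝ) / δ = 2 / (D + 1) := by rw [hδdef]; field_simp
  have hcorner : ∀ (q : Fin m → Fin K) i, (δ⁻¹ • (corner q - a)) i =
      2 * (((q i : ℕ) : ℝ) - mn i) / (D + 1) - 1 := by
    intro q i
    simp only [corner, ha, PiLp.smul_apply, PiLp.sub_apply, smul_eq_mul, hδdef]
    field_simp
    ring
  have hsub : ∀ q : Fin m → Fin K, (∀ i, 0 ≤ ((q i : ℕ) : ℝ) - mn i) →
      (∀ i, ((q i : ℕ) : ℝ) - mn i ≤ D) → cube (δ⁻¹ • (corner q - a)) (2 / (K : ℝ) / δ) ⊆ U m := by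
    intro q h0 h1 η hη i
    have := hη i
    rw [hcorner, hside] at this
    obtain ⟨t1, t2⟩ := this
    have u1 : 0 ≤ 2 * (((q i : ℕ) : ℝ) - mn i) / (D + 1) := by
      have := h0 i; positivity
    have u2 : 2 * (((q i : ℕ) : ℝ) - mn i) / (D + 1) + 2 / (D + 1) ≤ 2 := by
      rw [← add_div, div_le_iff₀ hD1]
      have := h1 i
      linarith
    exact ⟨by linarith, by linarith⟩
  have hmk : ∀ i, 0 ≤ ((k i : ℕ) : ℝ) - mn i ∧ ((k i : ℕ) : ℝ) - mn i ≤ D := by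
    intro i
    have := abs_le.1 (hDmax i)
    simp only [hmn]
    rcases min_cases ((k i : ℕ) : ℝ) ((l i : ℕ) : ℝ) with ⟨h, h'⟩ | ⟨h, h'⟩ <;> rw [h] <;>
      constructor <;> linarith
  have hml : ∀ i, 0 ≤ ((l i : ℕ) : ℝ) - mn i ∧ ((l i : ℕ) : ℝ) - mn i ≤ D := by
    intro i
    have := abs_le.1 (hDmax i)
    simp only [hmn]
    rcases min_cases ((k i : ℕ) : ℝ) ((l i : ℕ) : ℝ) with ⟨h, h'⟩ | ⟨h, h'⟩ <;> rw [h] <;>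
      constructor <;> linarith
  rw [bil_rescale a hδ hp Hk.meas Hl.meas]
  have hfac : ENNReal.ofReal (δ ^ ((m : ℝ) * p - (m + 2))) ≤ 1 :=
    ENNReal.ofReal_le_one.2 (Real.rpow_le_one hδ.le hδ1 hmp)
  refine (mul_le_mul' hfac (hB _ _ _ _ (by positivity) (by positivity)
    (hsub k (fun i => (hmk i).1) fun i => (hmk i).2)
    (hsub l (fun i => (hml i).1) fun i => (hml i).2) ?_ _ _ (Hk.rescale hδ) (Hl.rescale hδ))).trans
    (one_mul B).le
  intro x hx y hy
  have hd : |x i₀ - y i₀| ≤ dist x y := by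
    rw [EuclideanSpace.dist_eq, ← Real.dist_eq]
    apply Real.le_sqrt_of_sq_le
    exact Finset.single_le_sum (f := fun i => dist (x i) (y i) ^ 2) (fun i _ => sq_nonneg _)
      (Finset.mem_univ i₀)
  refine le_trans ?_ hd
  have hx' := hx i₀
  have hy' := hy i₀
  rw [hcorner, hside] at hx' hy'
  obtain ⟨x1, x2⟩ := hx'
  obtain ⟨y1, y2⟩ := hy'
  have hgap : 1 / 2 ≤ 2 * D / (D + 1) - 2 / (D + 1) := by
    rw [← sub_div, le_div_iff₀ hD1]; linarith
  have hsplit : ∀ u v : ℝ, 2 * u / (D + 1) - 2 * v / (D + 1) = 2 * (u - v) / (D + 1) := by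
    intro u v; ring
  have hs := hsplit (((k i₀ : ℕ) : ℝ) - mn i₀) (((l i₀ : ℕ) : ℝ) - mn i₀)
  rw [show ((k i₀ : ℕ) : ℝ) - mn i₀ - (((l i₀ : ℕ) : ℝ) - mn i₀) =
    ((k i₀ : ℕ) : ℝ) - ((l i₀ : ℕ) : ℝ) by ring] at hs
  rcases abs_cases (((k i₀ : ℕ) : ℝ) - ((l i₀ : ℕ) : ℝ)) with ⟨h, h'⟩ | ⟨h, h'⟩
  · rw [← hD] at h
    rw [← h] at hs
    refine le_trans ?_ (le_abs_self _)
    linarith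
  · rw [← hD] at h
    rw [show ((k i₀ : ℕ) : ℝ) - ((l i₀ : ℕ) : ℝ) = -D by linarith, mul_neg, neg_div] at hs
    refine le_trans ?_ (neg_le_abs _)
    linarith

lemma card_adj {m K : ℕ} (k : Fin m → Fin K) :
    (Finset.univ.filter fun l : Fin m → Fin K =>
      ∀ i, |((k i : ℕ) : ℤ) - ((l i : ℕ) : ℤ)| ≤ 1).card ≤ 3 ^ m := by
  have hsub : (Finset.univ.filter fun l : Fin m → Fin K =>
      ∀ i, |((k i : ℕ) : ℤ) - ((l i : ℕ) : ℤ)| ≤ 1) ⊆ Fintype.piFinset fun i =>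
        Finset.univ.filter fun y : Fin K => |((k i : ℕ) : ℤ) - ((y : ℕ) : ℤ)| ≤ 1 := by
    intro l hl
    simpa using hl
  refine (Finset.card_le_card hsub).trans ?_
  rw [Fintype.card_piFinset]
  refine (Finset.prod_le_prod' (g := fun _ => 3) fun i _ => ?_).trans (by simp)
  have := Finset.card_le_card_of_injOn (s := Finset.univ.filter fun y : Fin K => |((k i : ℕ) : ℤ) - ((y : ℕ) : ℤ)| ≤ 1)
    (t := Finset.Icc (((k i : ℕ) : ℤ) - 1) (((k i : ℕ) : ℤ) + 1)) (fun y : Fin K => ((y : ℕ) : ℤ))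
    (by
      intro y hy
      simp only [Finset.coe_filter, Finset.mem_univ, true_and, Set.mem_ofPred_eq, abs_le] at hy
      simp only [Finset.coe_Icc, Set.mem_Icc]
      omega)
    (by
      intro y _ z _ h
      ext
      simpa using h)
  refine this.trans ?_
  rw [Int.card_Icc]
  omega

/-- Broad-narrow inequality. -/
lemma broad_narrow {ι : Type*} [Fintype ι] [Nonempty ι] (r : ι → ι → Prop) [DecidableRel r] (M : ℕ)
    (hM : ∀ k, (Finset.univ.filter fun l => r k l).card ≤ M) {p : ℝ} (hp : 0 < p) (v : ι → ℝ≥0∞) :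
    (∑ k, v k) ^ p ≤ ((M : ℝ≥0∞) + 1) ^ p * ∑ k, v k ^ p +
      ((Fintype.card ι : ℝ≥0∞) ^ p * (Fintype.card ι : ℝ≥0∞) ^ (p / 2)) *
        ∑ k, ∑ l ∈ Finset.univ.filter (fun l => ¬ r k l), (v k * v l) ^ (p / 2) := by
  obtain ⟨k, hk⟩ := Finite.exists_max v
  set N : ℝ≥0∞ := (Fintype.card ι : ℝ≥0∞) with hN
  have hN0 : N ≠ 0 := by simp [hN]
  have hNt : N ≠ ⊤ := by simp [hN]
  by_cases hc : ∀ l, ¬ r k l → v l ≤ v k / N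
  · refine le_trans ?_ le_self_add
    have h1 : ∑ l, v l ≤ ((M : ℝ≥0∞) + 1) * v k := by
      rw [← Finset.sum_filter_add_sum_filter_not Finset.univ (fun l => r k l), add_mul, one_mul]
      gcongr
      · calc _ ≤ ∑ l ∈ Finset.univ.filter (fun l => r k l), v k := Finset.sum_le_sum fun l _ => hk l
          _ = ((Finset.univ.filter (fun l => r k l)).card : ℝ≥0∞) * v k := by simp
          _ ≤ _ := by gcongr; exact hM k
      · calc _ ≤ ∑ l ∈ Finset.univ.filter (fun l => ¬ r k l), v k / N :=
              Finset.sum_le_sum fun l hl => hc l (by simpa using hl)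
          _ ≤ ∑ l : ι, v k / N := Finset.sum_le_sum_of_subset (Finset.filter_subset _ _)
          _ = N * (v k / N) := by simp [hN]
          _ = v k := ENNReal.mul_div_cancel hN0 hNt
    calc _ ≤ (((M : ℝ≥0∞) + 1) * v k) ^ p := by gcongr
      _ = ((M : ℝ≥0∞) + 1) ^ p * v k ^ p := ENNReal.mul_rpow_of_nonneg _ _ hp.le
      _ ≤ _ := by
        gcongr
        exact Finset.single_le_sum (f := fun k => v k ^ p) (fun _ _ => zero_le) (Finset.mem_univ k)
  · push Not at hc
    obtain ⟨l, hl, hvl⟩ := hc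
    refine le_trans ?_ le_add_self
    have h1 : ∑ l, v l ≤ N * v k := by
      calc _ ≤ ∑ l : ι, v k := Finset.sum_le_sum fun l _ => hk l
        _ = _ := by simp [hN]
    have h2 : v k ≤ N * v l := by
      have := hvl.le
      rwa [ENNReal.div_le_iff hN0 hNt, mul_comm] at this
    calc _ ≤ (N * v k) ^ p := by gcongr
      _ = N ^ p * v k ^ p := ENNReal.mul_rpow_of_nonneg _ _ hp.le
      _ = N ^ p * (v k * v k) ^ (p / 2) := by
        rw [← sq, ← ENNReal.rpow_natCast, ← ENNReal.rpow_mul]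
        congr 2; push_cast; ring
      _ ≤ N ^ p * (v k * (N * v l)) ^ (p / 2) := by gcongr
      _ = N ^ p * N ^ (p / 2) * (v k * v l) ^ (p / 2) := by
        rw [mul_left_comm, ENNReal.mul_rpow_of_nonneg _ _ (by positivity : 0 ≤ p / 2), mul_assoc]
      _ ≤ _ := by
        gcongr
        calc (v k * v l) ^ (p / 2) ≤ ∑ l ∈ Finset.univ.filter (fun l => ¬ r k l), (v k * v l) ^ (p / 2) :=
              Finset.single_le_sum (f := fun l => (v k * v l) ^ (p / 2)) (fun _ _ => zero_le)
                (by simpa using hl)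
          _ ≤ _ := Finset.single_le_sum
              (f := fun k => ∑ l ∈ Finset.univ.filter (fun l => ¬ r k l), (v k * v l) ^ (p / 2))
              (fun _ _ => zero_le) (Finset.mem_univ k)

lemma choose_K {m : ℕ} {p : ℝ} (hmp : 0 < (m : ℝ) * p - (2 * m + 2)) : ∃ K : ℕ, 3 ≤ K ∧
    ((3 : ℝ) ^ m + 1) ^ p * ((K : ℝ) ^ m * (1 / K : ℝ) ^ ((m : ℝ) * p - (m + 2))) ≤ 1 / 2 := by
  have h1 := (tendsto_rpow_neg_atTop hmp).comp (tendsto_natCast_atTop_atTop (R := ℝ))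
  have h2 := h1.const_mul (((3 : ℝ) ^ m + 1) ^ p)
  rw [mul_zero] at h2
  have h3 := (h2.eventually (gt_mem_nhds (by norm_num : (0 : ℝ) < 1 / 2))).and
    (Filter.eventually_ge_atTop 3)
  obtain ⟨K, hK, hK3⟩ := h3.exists
  refine ⟨K, hK3, le_trans (le_of_eq ?_) hK.le⟩
  have hK0 : (0 : ℝ) < K := by exact_mod_cast (by omega : 0 < K)
  simp only [Function.comp]
  congr 1
  rw [one_div, Real.inv_rpow hK0.le, ← Real.rpow_neg hK0.le, ← Real.rpow_natCast, ← Real.rpow_add hK0]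
  congr 1; ring

lemma main_trunc {m : ℕ} {p : ℝ} (hp : 0 < p) (hmp : 0 < (m : ℝ) * p - (2 * m + 2)) {B : ℝ≥0∞}
    (hBt : B ≠ ⊤) (hB : BilHyp m p B) : ∃ C : ℝ≥0∞, C ≠ ⊤ ∧ ∀ R g, Adm (U m) g →
      ∫⁻ x in S m R, ‖Ext g x‖ₑ ^ p ≤ C := by
  obtain ⟨K, hK3, hK⟩ := choose_K hmp
  have hK0 : 0 < K := by omega
  have : Nonempty (Fin K) := ⟨⟨0, hK0⟩⟩
  set ι := Fin m → Fin K with hι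
  set c₂ : ℝ≥0∞ := (Fintype.card ι : ℝ≥0∞) ^ p * (Fintype.card ι : ℝ≥0∞) ^ (p / 2) with hc₂
  have hc₂t : c₂ ≠ ⊤ := by
    apply ENNReal.mul_ne_top <;> apply ENNReal.rpow_ne_top_of_nonneg (by positivity) (by simp)
  set Dc : ℝ≥0∞ := c₂ * ((Fintype.card ι : ℝ≥0∞) * ((Fintype.card ι : ℝ≥0∞) * B)) with hDc
  have hDct : Dc ≠ ⊤ := ENNReal.mul_ne_top hc₂t
    (ENNReal.mul_ne_top (by simp) (ENNReal.mul_ne_top (by simp) hBt))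
  refine ⟨2 * Dc, ENNReal.mul_ne_top (by simp) hDct, fun R => ?_⟩
  set A : ℝ≥0∞ := ⨆ (g : EuclideanSpace ℝ (Fin m) → ℂ) (_ : Adm (U m) g),
    ∫⁻ x in S m R, ‖Ext g x‖ₑ ^ p with hA
  have hgA : ∀ g, Adm (U m) g → ∫⁻ x in S m R, ‖Ext g x‖ₑ ^ p ≤ A := fun g hg =>
    le_iSup₂ (f := fun (g : EuclideanSpace ℝ (Fin m) → ℂ) (_ : Adm (U m) g) =>
      ∫⁻ x in S m R, ‖Ext g x‖ₑ ^ p) g hg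
  have hAt : A ≠ ⊤ := by
    have : A ≤ volume (U m) ^ p * volume (S m R) := by
      refine iSup₂_le fun g hg => ?_
      calc _ ≤ ∫⁻ x in S m R, volume (U m) ^ p := by
            apply lintegral_mono
            intro x
            exact ENNReal.rpow_le_rpow (hg.enorm_Ext_le x) hp.le
        _ = _ := by simp
    exact ne_top_of_le_ne_top (ENNReal.mul_ne_top
      (ENNReal.rpow_ne_top_of_nonneg hp.le (volume_U_lt m).ne) (volume_S_lt m R).ne) this
  have hrec : A ≤ A / 2 + Dc := by
    refine iSup₂_le fun g hg => ?_
    have hmeas : ∀ k : ι, Measurable (Ext (piece K g k)) := fun k => measurable_Ext (adm_piece_U hg k).meas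
    have hpt : ∀ x, ‖Ext g x‖ₑ ^ p ≤ (((3 ^ m : ℕ) : ℝ≥0∞) + 1) ^ p * ∑ k : ι, ‖Ext (piece K g k) x‖ₑ ^ p +
        c₂ * ∑ k : ι, ∑ l ∈ Finset.univ.filter
          (fun l : ι => ¬ ∀ i, |((k i : ℕ) : ℤ) - ((l i : ℕ) : ℤ)| ≤ 1),
          (‖Ext (piece K g k) x‖ₑ * ‖Ext (piece K g l) x‖ₑ) ^ (p / 2) := by
      intro x
      refine le_trans ?_ (broad_narrow (fun k l : ι => ∀ i, |((k i : ℕ) : ℤ) - ((l i : ℕ) : ℤ)| ≤ 1)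
        (3 ^ m) card_adj hp fun k => ‖Ext (piece K g k) x‖ₑ)
      rw [Ext_sum_piece hK0 hg x]
      gcongr
      exact enorm_sum_le _ _
    refine (lintegral_mono hpt).trans ?_
    rw [lintegral_add_left (by fun_prop), lintegral_const_mul _ (by fun_prop),
      lintegral_const_mul _ (by fun_prop), lintegral_finsetSum _ (by fun_prop),
      lintegral_finsetSum _ (by fun_prop)]
    gcongr
    · have h1 : ∀ k : ι, ∫⁻ x in S m R, ‖Ext (piece K g k) x‖ₑ ^ p ≤
          ENNReal.ofReal ((1 / K : ℝ) ^ ((m : ℝ) * p - (m + 2))) * A := by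
        intro k
        obtain ⟨g', hg', h⟩ := piece_lin hK3 hp.le R hg k
        exact h.trans (by gcongr; exact hgA g' hg')
      calc _ ≤ (((3 ^ m : ℕ) : ℝ≥0∞) + 1) ^ p * ∑ k : ι,
            ENNReal.ofReal ((1 / K : ℝ) ^ ((m : ℝ) * p - (m + 2))) * A := by
            gcongr with k; exact h1 k
        _ = ENNReal.ofReal (((3 : ℝ) ^ m + 1) ^ p * ((K : ℝ) ^ m * (1 / K : ℝ) ^ ((m : ℝ) * p - (m + 2)))) * A := by
            rw [Finset.sum_const, nsmul_eq_mul, ENNReal.ofReal_mul (by positivity),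
              ENNReal.ofReal_mul (by positivity), ← ENNReal.ofReal_rpow_of_nonneg (by positivity) hp.le,
              ENNReal.ofReal_add (by positivity) (by positivity), ENNReal.ofReal_pow (by positivity),
              ENNReal.ofReal_pow (by positivity)]
            simp [hι, mul_assoc]
        _ ≤ ENNReal.ofReal (1 / 2) * A := by gcongr
        _ = A / 2 := by
            rw [ENNReal.ofReal_div_of_pos (by norm_num)]
            simp [ENNReal.div_eq_inv_mul]
    · rw [hDc]
      gcongr
      calc _ ≤ ∑ k : ι, (Fintype.card ι : ℝ≥0∞) * B := by
            gcongr with k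
            rw [lintegral_finsetSum _ (by fun_prop)]
            calc _ ≤ ∑ l ∈ Finset.univ.filter
                  (fun l : ι => ¬ ∀ i, |((k i : ℕ) : ℤ) - ((l i : ℕ) : ℤ)| ≤ 1), B := by
                  apply Finset.sum_le_sum
                  intro l hl
                  refine (setLIntegral_le_lintegral _ _).trans ?_
                  exact piece_bil hp.le (by nlinarith [(Nat.cast_nonneg m : (0:ℝ) ≤ m)]) hB hg k l
                    (by simpa using hl)
              _ ≤ ∑ l : ι, B := Finset.sum_le_sum_of_subset (Finset.filter_subset _ _)
              _ = _ := by simp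
        _ = _ := by simp
  have hA2 : A / 2 ≤ Dc := by
    have h2 : A / 2 + A / 2 ≤ A / 2 + Dc := by rwa [ENNReal.add_halves]
    exact (ENNReal.add_le_add_iff_left (ENNReal.div_ne_top hAt (by simp))).1 h2
  intro g hg
  refine (hgA g hg).trans ?_
  rw [← ENNReal.add_halves A, two_mul]
  gcongr

lemma main_full {m : ℕ} {p : ℝ} (hp : 0 < p) (hmp : 0 < (m : ℝ) * p - (2 * m + 2)) {B : ℝ≥0∞}
    (hBt : B ≠ ⊤) (hB : BilHyp m p B) : ∃ C : ℝ≥0∞, C ≠ ⊤ ∧ ∀ g, Adm (U m) g →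
      ∫⁻ x, ‖Ext g x‖ₑ ^ p ≤ C := by
  obtain ⟨C, hC, h⟩ := main_trunc hp hmp hBt hB
  refine ⟨C, hC, fun g hg => ?_⟩
  have hU : ⋃ N : ℕ, S m N = Set.univ := by
    rw [Set.eq_univ_iff_forall]
    intro x
    obtain ⟨N, hN⟩ := exists_nat_ge (∑ i, |x.1 i| + |x.2|)
    refine Set.mem_iUnion.2 ⟨N, mem_S.2 ⟨fun i => ?_, ?_⟩⟩
    · have := Finset.single_le_sum (f := fun i => |x.1 i|) (fun i _ => abs_nonneg _) (Finset.mem_univ i)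
      have h2 := abs_nonneg x.2
      dsimp only at this
      linarith
    · have : 0 ≤ ∑ i, |x.1 i| := Finset.sum_nonneg fun i _ => abs_nonneg _
      linarith
  have hmono : Monotone fun N : ℕ => S m N := by
    intro N N' hN x hx
    have hN' : (N : ℝ) ≤ N' := by exact_mod_cast hN
    exact mem_S.2 ⟨fun i => ((mem_S.1 hx).1 i).trans hN', (mem_S.1 hx).2.trans hN'⟩
  rw [← setLIntegral_univ, ← hU, setLIntegral_iUnion_of_directed _ hmono.directed_le]
  exact iSup_le fun N => h N g hg

lemma bilHyp_of {m : ℕ} {p C₀ : ℝ} (hp : 0 < p)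
    (hBR : ∀ (a₁ a₂ : EuclideanSpace ℝ (Fin m)) (s₁ s₂ : ℝ),
      0 < s₁ → 0 < s₂ →
      cube a₁ s₁ ⊆ U m → cube a₂ s₂ ⊆ U m →
      (∀ x ∈ cube a₁ s₁, ∀ y ∈ cube a₂ s₂, (1 : ℝ) / 2 ≤ dist x y) →
      ∀ f : EuclideanSpace ℝ (Fin m) → ℂ,
        Measurable f → (∃ M : ℝ, ∀ x, ‖f x‖ ≤ M) →
        (∫⁻ x : EuclideanSpace ℝ (Fin m) × ℝ,
            (‖parabExt (cube a₁ s₁) f x‖ₑ * ‖parabExt (cube a₂ s₂) f x‖ₑ) ^ (p / 2)) ^ (1 / p) ≤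
          ENNReal.ofReal C₀ *
            (eLpNorm f ⊤ (volume.restrict (cube a₁ s₁)) *
              eLpNorm f ⊤ (volume.restrict (cube a₂ s₂))) ^ (1 / (2 : ℝ))) :
    BilHyp m p (ENNReal.ofReal C₀ ^ p) := by
  intro a₁ a₂ s₁ s₂ hs₁ hs₂ hc₁ hc₂ hd h₁ h₂ H₁ H₂
  have hne : ∀ x, x ∈ cube a₁ s₁ → x ∉ cube a₂ s₂ := by
    intro x hx hx'
    have := hd x hx x hx'
    rw [dist_self] at this
    norm_num at this
  have key := hBR a₁ a₂ s₁ s₂ hs₁ hs₂ hc₁ hc₂ hd (fun x => h₁ x + h₂ x) (H₁.meas.add H₂.meas)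
    ⟨2, fun x => (norm_add_le _ _).trans (by linarith [H₁.bd x, H₂.bd x])⟩
  have e₁ : (cube a₁ s₁).indicator (fun x => h₁ x + h₂ x) = h₁ := by
    ext x
    by_cases hx : x ∈ cube a₁ s₁
    · simp [hx, H₂.supp x (hne x hx)]
    · simp [hx, H₁.supp x hx]
  have e₂ : (cube a₂ s₂).indicator (fun x => h₁ x + h₂ x) = h₂ := by
    ext x
    by_cases hx : x ∈ cube a₂ s₂
    · simp [hx, H₁.supp x (fun h => hne x h hx)]
    · simp [hx, H₂.supp x hx]
  rw [parabExt_eq (measurableSet_cube _ _), parabExt_eq (measurableSet_cube _ _), e₁, e₂] at key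
  have n₁ : eLpNorm (fun x => h₁ x + h₂ x) ⊤ (volume.restrict (cube a₁ s₁)) ≤ 1 := by
    rw [eLpNorm_exponent_top]
    refine eLpNormEssSup_le_of_ae_enorm_bound (ae_restrict_of_forall_mem (measurableSet_cube _ _) ?_)
    intro x hx
    rw [H₂.supp x (hne x hx), add_zero, ← ofReal_norm]
    exact ENNReal.ofReal_le_one.2 (H₁.bd x)
  have n₂ : eLpNorm (fun x => h₁ x + h₂ x) ⊤ (volume.restrict (cube a₂ s₂)) ≤ 1 := by
    rw [eLpNorm_exponent_top]
    refine eLpNormEssSup_le_of_ae_enorm_bound (ae_restrict_of_forall_mem (measurableSet_cube _ _) ?_)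
    intro x hx
    rw [H₁.supp x (fun h => hne x h hx), zero_add, ← ofReal_norm]
    exact ENNReal.ofReal_le_one.2 (H₂.bd x)
  have key2 : (∫⁻ x, (‖Ext h₁ x‖ₑ * ‖Ext h₂ x‖ₑ) ^ (p / 2)) ^ (1 / p) ≤ ENNReal.ofReal C₀ := by
    refine key.trans ?_
    calc _ ≤ ENNReal.ofReal C₀ * (1 * 1) ^ (1 / (2 : ℝ)) := by gcongr
      _ = _ := by simp
  rwa [one_div, ENNReal.rpow_inv_le_iff hp] at key2

lemma normalize {m : ℕ} {p : ℝ} (hp : 0 < p) {C : ℝ≥0∞}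
    (hC : ∀ g, Adm (U m) g → ∫⁻ x, ‖Ext g x‖ₑ ^ p ≤ C) (f : EuclideanSpace ℝ (Fin m) → ℂ)
    (hf : Measurable f) (hb : ∃ M : ℝ, ∀ x, ‖f x‖ ≤ M) :
    (∫⁻ x, ‖parabExt (U m) f x‖ₑ ^ p) ^ (1 / p) ≤
      C ^ (1 / p) * eLpNorm f ⊤ (volume.restrict (U m)) := by
  set L := eLpNorm f ⊤ (volume.restrict (U m)) with hL
  have hLt : L ≠ ⊤ := by
    obtain ⟨M, hM⟩ := hb
    rw [hL, eLpNorm_exponent_top]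
    exact ne_top_of_le_ne_top ENNReal.ofReal_ne_top
      (eLpNormEssSup_le_of_ae_bound (C := M) (Filter.Eventually.of_forall hM))
  set ℓ : ℝ := L.toReal with hℓ
  have hℓ0 : 0 ≤ ℓ := ENNReal.toReal_nonneg
  have hae : ∀ᵐ ξ ∂(volume.restrict (U m)), ‖f ξ‖ ≤ ℓ := by
    have := ae_le_eLpNormEssSup (f := f) (μ := volume.restrict (U m))
    filter_upwards [this] with ξ hξ
    rw [← eLpNorm_exponent_top, ← hL] at hξ
    have := ENNReal.toReal_mono hLt hξ
    simpa using this
  set W : Set (EuclideanSpace ℝ (Fin m)) := U m ∩ {ξ | ‖f ξ‖ ≤ ℓ} with hW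
  have hWm : MeasurableSet W := (measurableSet_U m).inter (measurableSet_le hf.norm measurable_const)
  set g : EuclideanSpace ℝ (Fin m) → ℂ := W.indicator fun ξ => ((ℓ⁻¹ : ℝ) : ℂ) * f ξ with hg
  have hgA : Adm (U m) g := by
    refine ⟨(measurable_const.mul hf).indicator hWm, fun ξ => ?_, fun ξ hξ => ?_⟩
    · by_cases h : ξ ∈ W
      · rw [hg, Set.indicator_of_mem h, norm_mul, Complex.norm_real, Real.norm_eq_abs,
          abs_of_nonneg (inv_nonneg.2 hℓ0)]
        exact inv_mul_le_one_of_le₀ h.2 hℓ0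
      · rw [hg, Set.indicator_of_notMem h]; simp
    · exact Set.indicator_of_notMem (fun h => hξ h.1) _
  have hE : ∀ x, ‖parabExt (U m) f x‖ₑ = L * ‖Ext g x‖ₑ := by
    intro x
    have : parabExt (U m) f x = (ℓ : ℂ) * Ext g x := by
      rw [parabExt_eq (measurableSet_U m)]
      unfold Ext
      rw [← integral_const_mul]
      apply integral_congr_ae
      rw [ae_restrict_iff' (measurableSet_U m)] at hae
      filter_upwards [hae] with ξ hξ
      by_cases hU : ξ ∈ U m
      · have hw : ξ ∈ W := ⟨hU, hξ hU⟩
        rw [Set.indicator_of_mem hU, hg, Set.indicator_of_mem hw]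
        rcases eq_or_lt_of_le hℓ0 with h0 | h0
        · have : f ξ = 0 := by
            have := hξ hU
            rw [← h0] at this
            exact norm_le_zero_iff.1 this
          simp [this]
        · have : (ℓ : ℂ) ≠ 0 := by exact_mod_cast h0.ne'
          push_cast
          field_simp
      · rw [Set.indicator_of_notMem hU, hgA.supp ξ hU]; simp
    rw [this, enorm_mul]
    congr 1
    rw [← ofReal_norm, Complex.norm_real, Real.norm_eq_abs, abs_of_nonneg hℓ0, hℓ,
      ENNReal.ofReal_toReal hLt]
  simp_rw [hE, ENNReal.mul_rpow_of_nonneg _ _ hp.le]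
  have hm := measurable_Ext hgA.meas
  rw [lintegral_const_mul _ (by fun_prop), ENNReal.mul_rpow_of_nonneg _ _ (by positivity : 0 ≤ 1 / p),
    ← ENNReal.rpow_mul, mul_one_div_cancel hp.ne', ENNReal.rpow_one, mul_comm]
  gcongr
  exact hC g hgA

end BilLin

/-- **Bilinear restriction implies linear restriction.** Let `n ≥ 2` and let `p` satisfy
`2n/(n−1) < p ≤ 4` if `n ≥ 3` and `p > 4` if `n = 2`. If the bilinear extension estimate
with `L^∞`-norms and constant `C₀` holds for all pairs of cubes in `[−1,1]^{n−1}` separated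
by at least `1/2`, then the linear extension estimate
`‖E_{[−1,1]^{n−1}} f‖_{L^p(ℝ^n)} ≤ C ‖f‖_{L^∞([−1,1]^{n−1})}` holds for some `C < ∞`. -/
theorem bilinear_implies_linear_restriction (n : ℕ) (hn : 2 ≤ n) (p : ℝ)
    (hp3 : 3 ≤ n → (2 * (n : ℝ) / ((n : ℝ) - 1) < p ∧ p ≤ 4)) (hp2 : n = 2 → 4 < p)
    (C₀ : ℝ) (hC₀ : 0 ≤ C₀)
    (hBR : ∀ (a₁ a₂ : EuclideanSpace ℝ (Fin (n - 1))) (s₁ s₂ : ℝ),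
      0 < s₁ → 0 < s₂ →
      cube a₁ s₁ ⊆ {ξ | ∀ i, ξ i ∈ Set.Icc (-1 : ℝ) 1} →
      cube a₂ s₂ ⊆ {ξ | ∀ i, ξ i ∈ Set.Icc (-1 : ℝ) 1} →
      (∀ x ∈ cube a₁ s₁, ∀ y ∈ cube a₂ s₂, (1 : ℝ) / 2 ≤ dist x y) →
      ∀ f : EuclideanSpace ℝ (Fin (n - 1)) → ℂ,
        Measurable f → (∃ M : ℝ, ∀ x, ‖f x‖ ≤ M) →
        (∫⁻ x : EuclideanSpace ℝ (Fin (n - 1)) × ℝ,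
            ((‖parabExt (cube a₁ s₁) f x‖₊ : ℝ≥0∞) *
              (‖parabExt (cube a₂ s₂) f x‖₊ : ℝ≥0∞)) ^ (p / 2)) ^ (1 / p) ≤
          ENNReal.ofReal C₀ *
            (eLpNorm f ⊤ (volume.restrict (cube a₁ s₁)) *
              eLpNorm f ⊤ (volume.restrict (cube a₂ s₂))) ^ (1 / (2 : ℝ))) :
    ∃ C : ℝ, 0 < C ∧
      ∀ f : EuclideanSpace ℝ (Fin (n - 1)) → ℂ,
        Measurable f → (∃ M : ℝ, ∀ x, ‖f x‖ ≤ M) →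
        (∫⁻ x : EuclideanSpace ℝ (Fin (n - 1)) × ℝ,
            (‖parabExt {ξ | ∀ i, ξ i ∈ Set.Icc (-1 : ℝ) 1} f x‖₊ : ℝ≥0∞) ^ p) ^ (1 / p) ≤
          ENNReal.ofReal C *
            eLpNorm f ⊤ (volume.restrict {ξ | ∀ i, ξ i ∈ Set.Icc (-1 : ℝ) 1}) := by
  obtain ⟨hp, hmp⟩ : 0 < p ∧ 0 < ((n - 1 : ℕ) : ℝ) * p - (2 * ((n - 1 : ℕ) : ℝ) + 2) := by
    have hn' : (2 : ℝ) ≤ n := by exact_mod_cast hn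
    rw [Nat.cast_sub (by omega)]
    push_cast
    rcases Nat.lt_or_ge n 3 with h | h
    · have h2 : n = 2 := by omega
      have := hp2 h2
      subst h2
      constructor
      · linarith
      · push_cast; linarith
    · obtain ⟨h1, -⟩ := hp3 h
      have h0 : (0 : ℝ) < n - 1 := by linarith
      constructor
      · exact lt_trans (by positivity) h1
      · rw [div_lt_iff₀ h0] at h1
        linarith
  have hB := BilLin.bilHyp_of hp hBR
  obtain ⟨C, hCt, hC⟩ := BilLin.main_full hp hmp
    (ENNReal.rpow_ne_top_of_nonneg hp.le ENNReal.ofReal_ne_top) hB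
  have hCt' : C ^ (1 / p) ≠ ⊤ := ENNReal.rpow_ne_top_of_nonneg (by positivity) hCt
  refine ⟨(C ^ (1 / p)).toReal + 1, by positivity, fun f hf hb => ?_⟩
  refine (BilLin.normalize hp hC f hf hb).trans ?_
  refine mul_le_mul' ?_ le_rfl
  rw [← ENNReal.ofReal_toReal hCt']
  apply ENNReal.ofReal_le_ofReal
  simp
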